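/- Let (f,g,ρ) be a warped Berger solution of Ricci flow on S^1×S^3 defined on [0,T) with f(·,0) ≤ g(·,0). Define C_f := max{ 2/√3, max_ξ |f_s(ξ,0)| } and C_g := max{ 2√2, max_ξ |g_s(ξ,0)| }. Then |f_s(ξ,t)| ≤ C_f and |g_s(ξ,t)| ≤ C_g for all (ξ,t) ∈ S^1×[0,T). -/

import Mathlib

open Real Set Filter Topology
open scoped ENNReal

noncomputable section

/-- Partial derivative in the first (spatial, `ξ`) variable. -/
def pd1 (φ : ℝ → ℝ → ℝ) (ξ t : ℝ) : ℝ := deriv (fun x => φ x t) ξ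

/-- Partial derivative in the second (time) variable: `φ_t`. -/
def pdt (φ : ℝ → ℝ → ℝ) (ξ t : ℝ) : ℝ := deriv (fun τ => φ ξ τ) t

/-- Derivative with respect to arclength `s` (where `ds = ρ dξ`): `φ_s := ρ⁻¹ ∂_ξ φ`. -/
def Ds (ρ φ : ℝ → ℝ → ℝ) (ξ t : ℝ) : ℝ := pd1 φ ξ t / ρ ξ t

/-- `t` lies in the existence interval `[0,T)`, where `T ∈ (0,∞]`. -/
def InDom (T : ℝ≥0∞) (t : ℝ) : Prop := 0 ≤ t ∧ ENNReal.ofReal t < T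

/-- A warped Berger solution of Ricci flow on `S¹ × S³` with existence time `T ∈ (0,∞]`:
smooth positive `2π`-periodic-in-`ξ` functions `f, g, ρ` on `S¹ × [0,T)` satisfying
  `f_t = f_ss + 2 (g_s/g) f_s − 2 f³/g⁴`,
  `g_t = g_ss + (f_s/f + g_s/g) g_s + 2 (f² − 2g²)/g³`,
  `(log ρ)_t = f_ss/f + 2 g_ss/g`. -/
structure WarpedBerger (T : ℝ≥0∞) (f g ρ : ℝ → ℝ → ℝ) : Prop where
  T_pos : 0 < T
  f_pos : ∀ ξ t : ℝ, InDom T t → 0 < f ξ t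
  g_pos : ∀ ξ t : ℝ, InDom T t → 0 < g ξ t
  ρ_pos : ∀ ξ t : ℝ, InDom T t → 0 < ρ ξ t
  f_per : ∀ ξ t : ℝ, f (ξ + 2 * π) t = f ξ t
  g_per : ∀ ξ t : ℝ, g (ξ + 2 * π) t = g ξ t
  ρ_per : ∀ ξ t : ℝ, ρ (ξ + 2 * π) t = ρ ξ t
  smooth : ContDiffOn ℝ (⊤ : ℕ∞)
      (fun p : ℝ × ℝ => (f p.1 p.2, g p.1 p.2, ρ p.1 p.2)) (Set.univ ×ˢ {t : ℝ | InDom T t})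
  eq_f : ∀ ξ t : ℝ, 0 < t → InDom T t →
    pdt f ξ t = Ds ρ (Ds ρ f) ξ t + 2 * (Ds ρ g ξ t / g ξ t) * Ds ρ f ξ t
      - 2 * (f ξ t) ^ 3 / (g ξ t) ^ 4
  eq_g : ∀ ξ t : ℝ, 0 < t → InDom T t →
    pdt g ξ t = Ds ρ (Ds ρ g) ξ t
      + (Ds ρ f ξ t / f ξ t + Ds ρ g ξ t / g ξ t) * Ds ρ g ξ t
      + 2 * ((f ξ t) ^ 2 - 2 * (g ξ t) ^ 2) / (g ξ t) ^ 3
  eq_ρ : ∀ ξ t : ℝ, 0 < t → InDom T t →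
    pdt (fun x τ => Real.log (ρ x τ)) ξ t
      = Ds ρ (Ds ρ f) ξ t / f ξ t + 2 * (Ds ρ (Ds ρ g) ξ t / g ξ t)

/-- open domain -/
def UU (T : ℝ≥0∞) : Set (ℝ × ℝ) := {p | 0 < p.2 ∧ ENNReal.ofReal p.2 < T}

/-- smooth on the open domain -/
def Sm (T : ℝ≥0∞) (φ : ℝ → ℝ → ℝ) : Prop :=
  ContDiffOn ℝ (⊤ : ℕ∞) (fun p : ℝ × ℝ => φ p.1 p.2) (UU T)

lemma UU_open (T : ℝ≥0∞) : IsOpen (UU T) := by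
  apply IsOpen.inter
  · exact isOpen_lt continuous_const continuous_snd
  · exact isOpen_lt (ENNReal.continuous_ofReal.comp continuous_snd) continuous_const

lemma Sm.cda {T : ℝ≥0∞} {φ : ℝ → ℝ → ℝ} (h : Sm T φ) {ξ t : ℝ} (ht : (ξ, t) ∈ UU T) :
    ContDiffAt ℝ (⊤ : ℕ∞) (fun p : ℝ × ℝ => φ p.1 p.2) (ξ, t) :=
  ContDiffOn.contDiffAt h ((UU_open T).mem_nhds ht)

lemma Sm.hfd {T : ℝ≥0∞} {φ : ℝ → ℝ → ℝ} (h : Sm T φ) {ξ t : ℝ} (ht : (ξ, t) ∈ UU T) :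
    HasFDerivAt (fun p : ℝ × ℝ => φ p.1 p.2)
      (fderiv ℝ (fun p : ℝ × ℝ => φ p.1 p.2) (ξ, t)) (ξ, t) :=
  ((h.cda ht).differentiableAt (by simp)).hasFDerivAt

lemma Sm.hd1' {T : ℝ≥0∞} {φ : ℝ → ℝ → ℝ} (h : Sm T φ) {ξ t : ℝ} (ht : (ξ, t) ∈ UU T) :
    HasDerivAt (fun x => φ x t)
      (fderiv ℝ (fun p : ℝ × ℝ => φ p.1 p.2) (ξ, t) (1, 0)) ξ :=
  HasFDerivAt.comp_hasDerivAt (f := fun x : ℝ => (x, t)) ξ (h.hfd ht)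
    ((hasDerivAt_id ξ).prodMk (hasDerivAt_const ξ t))

lemma Sm.hdt' {T : ℝ≥0∞} {φ : ℝ → ℝ → ℝ} (h : Sm T φ) {ξ t : ℝ} (ht : (ξ, t) ∈ UU T) :
    HasDerivAt (fun τ => φ ξ τ)
      (fderiv ℝ (fun p : ℝ × ℝ => φ p.1 p.2) (ξ, t) (0, 1)) t :=
  HasFDerivAt.comp_hasDerivAt (f := fun τ : ℝ => (ξ, τ)) t (h.hfd ht)
    ((hasDerivAt_const t ξ).prodMk (hasDerivAt_id t))

lemma Sm.hd1 {T : ℝ≥0∞} {φ : ℝ → ℝ → ℝ} (h : Sm T φ) {ξ t : ℝ} (ht : (ξ, t) ∈ UU T) :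
    HasDerivAt (fun x => φ x t) (pd1 φ ξ t) ξ := (h.hd1' ht).differentiableAt.hasDerivAt

lemma Sm.hdt {T : ℝ≥0∞} {φ : ℝ → ℝ → ℝ} (h : Sm T φ) {ξ t : ℝ} (ht : (ξ, t) ∈ UU T) :
    HasDerivAt (fun x => φ ξ x) (pdt φ ξ t) t := (h.hdt' ht).differentiableAt.hasDerivAt

lemma Sm.fd {T : ℝ≥0∞} {φ : ℝ → ℝ → ℝ} (h : Sm T φ) :
    ContDiffOn ℝ (⊤ : ℕ∞) (fderiv ℝ (fun p : ℝ × ℝ => φ p.1 p.2)) (UU T) :=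
  ContDiffOn.fderiv_of_isOpen (n := (⊤ : ℕ∞)) h (UU_open T) (by simp)

lemma Sm.pd1 {T : ℝ≥0∞} {φ : ℝ → ℝ → ℝ} (h : Sm T φ) : Sm T (pd1 φ) :=
  (h.fd.clm_apply (contDiffOn_const (c := ((1, 0) : ℝ × ℝ)))).congr
    (fun p hp => (h.hd1' (ξ := p.1) (t := p.2) hp).deriv)

lemma Sm.pdt {T : ℝ≥0∞} {φ : ℝ → ℝ → ℝ} (h : Sm T φ) : Sm T (pdt φ) :=
  (h.fd.clm_apply (contDiffOn_const (c := ((0, 1) : ℝ × ℝ)))).congr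
    (fun p hp => (h.hdt' (ξ := p.1) (t := p.2) hp).deriv)

lemma Sm.comm {T : ℝ≥0∞} {φ : ℝ → ℝ → ℝ} (h : Sm T φ) {ξ t : ℝ} (ht : (ξ, t) ∈ UU T) :
    _root_.pdt (_root_.pd1 φ) ξ t = _root_.pd1 (_root_.pdt φ) ξ t := by
  have hU := (UU_open T).mem_nhds ht
  have e1 := (h.pd1.hdt' ht).deriv
  have e2 := (h.pdt.hd1' ht).deriv
  have f1 : (fun p : ℝ × ℝ => _root_.pd1 φ p.1 p.2) =ᶠ[𝓝 (ξ, t)]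
      fun p => fderiv ℝ (fun p : ℝ × ℝ => φ p.1 p.2) p (1, 0) := by
    filter_upwards [hU] with p hp
    exact (h.hd1' (ξ := p.1) (t := p.2) hp).deriv
  have f2 : (fun p : ℝ × ℝ => _root_.pdt φ p.1 p.2) =ᶠ[𝓝 (ξ, t)]
      fun p => fderiv ℝ (fun p : ℝ × ℝ => φ p.1 p.2) p (0, 1) := by
    filter_upwards [hU] with p hp
    exact (h.hdt' (ξ := p.1) (t := p.2) hp).deriv
  have hD : DifferentiableAt ℝ (fderiv ℝ (fun p : ℝ × ℝ => φ p.1 p.2)) (ξ, t) :=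
    (h.fd.contDiffAt hU).differentiableAt (by simp)
  have g (v : ℝ × ℝ) := (hD.hasFDerivAt.clm_apply (hasFDerivAt_const v (ξ, t))).fderiv
  rw [f1.fderiv_eq, g] at e1
  rw [f2.fderiv_eq, g] at e2
  change deriv _ _ = deriv _ _
  rw [e1, e2]
  have := (h.cda ht).isSymmSndFDerivAt (by simp; exact WithTop.coe_le_coe.2 (le_top (a := (2:ℕ∞))))
  simpa using this (0, 1) (1, 0)

lemma Sm.neg {T : ℝ≥0∞} {φ : ℝ → ℝ → ℝ} (h : Sm T φ) : Sm T (fun x t => - φ x t) :=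
  ContDiffOn.neg h

lemma Sm.div {T : ℝ≥0∞} {φ ψ : ℝ → ℝ → ℝ} (h : Sm T φ) (h' : Sm T ψ)
    (h0 : ∀ ξ t, InDom T t → 0 < ψ ξ t) : Sm T (fun x t => φ x t / ψ x t) :=
  ContDiffOn.div h h' (fun p hp => (h0 p.1 p.2 ⟨hp.1.le, hp.2⟩).ne')

lemma Sm.Ds {T : ℝ≥0∞} {φ ψ : ℝ → ℝ → ℝ} (h : Sm T φ) (h' : Sm T ψ)
    (h0 : ∀ ξ t, InDom T t → 0 < ψ ξ t) : Sm T (Ds ψ φ) := h.pd1.div h' h0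

lemma second_test {h k r : ℝ → ℝ} {x K : ℝ} (hm : ∀ y, h y ≤ h x)
    (hd : ∀ y, HasDerivAt h (r y * k y) y) (hr : 0 < r x) (hrd : DifferentiableAt ℝ r x)
    (hk : HasDerivAt k K x) : k x = 0 ∧ K ≤ 0 := by
  have hmax : IsLocalMax h x := Eventually.of_forall hm
  have hder : deriv h = fun y => r y * k y := funext fun y => (hd y).deriv
  have h0 : r x * k x = 0 := by rw [← (hd x).deriv]; exact hmax.deriv_eq_zero
  have hkx : k x = 0 := by simpa [hr.ne'] using h0
  refine ⟨hkx, ?_⟩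
  by_contra hK
  push Not at hK
  have hdd : deriv (deriv h) x = r x * K := by
    rw [hder, (hrd.hasDerivAt.fun_mul hk).deriv, hkx]; ring
  have hmin := isLocalMin_of_deriv_deriv_pos (f := h) (x₀ := x)
    (by rw [hdd]; positivity) hmax.deriv_eq_zero (hd x).continuousAt
  have hc : h =ᶠ[𝓝 x] fun _ => h x := by
    filter_upwards [hmin] with y hy using le_antisymm (hm y) hy
  have : deriv (deriv h) x = 0 := by
    rw [hc.deriv.deriv_eq]; simp
  rw [hdd] at this
  have := mul_pos hr hK
  linarith

lemma maxPrinciple {T : ℝ≥0∞} {ρ v : ℝ → ℝ → ℝ} (hρ : ∀ ξ t, InDom T t → 0 < ρ ξ t)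
    (sρ : Sm T ρ) (sv : Sm T v) (per : ∀ ξ t, v (ξ + 2 * π) t = v ξ t)
    (cont : ContinuousOn (fun p : ℝ × ℝ => v p.1 p.2) (univ ×ˢ {t : ℝ | InDom T t}))
    (C : ℝ) (h0 : ∀ ξ, v ξ 0 ≤ C)
    (key : ∀ ξ t, 0 < t → InDom T t → C < v ξ t → Ds ρ v ξ t = 0 → Ds ρ (Ds ρ v) ξ t ≤ 0 →
      pdt v ξ t ≤ 0) :
    ∀ ξ t, InDom T t → v ξ t ≤ C := by
  intro ξ₁ τ hτ
  by_contra hlt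
  push Not at hlt
  have hτ0 : 0 < τ := lt_of_le_of_ne hτ.1 (by rintro rfl; linarith [h0 ξ₁])
  have hdom : ∀ t, 0 ≤ t → t ≤ τ → InDom T t := fun t a b =>
    ⟨a, lt_of_le_of_lt (ENNReal.ofReal_le_ofReal b) hτ.2⟩
  obtain ⟨ε, hε, hε2⟩ : ∃ ε > 0, C < v ξ₁ τ - ε * τ := by
    refine ⟨(v ξ₁ τ - C) / (2 * τ), div_pos (by linarith) (by linarith), ?_⟩
    have : (v ξ₁ τ - C) / (2 * τ) * τ = (v ξ₁ τ - C) / 2 := by field_simp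
    rw [this]; linarith
  have hcpt : IsCompact (Icc (0:ℝ) (2 * π) ×ˢ Icc (0:ℝ) τ) := isCompact_Icc.prod isCompact_Icc
  have hcont : ContinuousOn (fun p : ℝ × ℝ => v p.1 p.2 - ε * p.2)
      (Icc (0:ℝ) (2 * π) ×ˢ Icc (0:ℝ) τ) := by
    refine ContinuousOn.sub (cont.mono ?_) (by fun_prop)
    rintro p ⟨_, hp⟩
    exact ⟨trivial, hdom _ hp.1 hp.2⟩
  obtain ⟨⟨x, t⟩, ⟨hx, ht⟩, hmax⟩ := hcpt.exists_isMaxOn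
    ⟨(0, 0), ⟨⟨le_rfl, by positivity⟩, ⟨le_rfl, hτ0.le⟩⟩⟩ hcont
  have hall : ∀ y s, 0 ≤ s → s ≤ τ → v y s - ε * s ≤ v x t - ε * t := by
    intro y s hs hs'
    have hp : Function.Periodic (fun z => v z s) (2 * π) := fun z => per z s
    obtain ⟨z, hz, hz'⟩ := hp.exists_mem_Ico₀ (by positivity) y
    have : v z s - ε * s ≤ v x t - ε * t :=
      hmax (show (z, s) ∈ _ from ⟨⟨hz.1, hz.2.le⟩, ⟨hs, hs'⟩⟩)
    have e : v y s = v z s := hz'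
    rw [e]; exact this
  simp only at hx ht
  have hC : C < v x t - ε * t := lt_of_lt_of_le hε2 (hall _ _ hτ0.le le_rfl)
  have ht0 : 0 < t := lt_of_le_of_ne ht.1 (by rintro rfl; linarith [h0 x])
  have hD := hdom t ht.1 ht.2
  have hU : ∀ y, (y, t) ∈ UU T := fun y => ⟨ht0, hD.2⟩
  have sD := sv.Ds sρ hρ
  have hsec := second_test (h := fun y => v y t) (k := fun y => Ds ρ v y t)
    (r := fun y => ρ y t) (x := x) (fun y => by linarith [hall y t ht.1 ht.2])
    (fun y => by
      have := sv.hd1 (hU y)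
      have e : ρ y t * Ds ρ v y t = pd1 v y t := by
        have := (hρ y t hD).ne'
        unfold Ds; field_simp
      rw [e]; exact this) (hρ x t hD) (sρ.hd1 (hU x)).differentiableAt (sD.hd1 (hU x))
  have hle := key x t ht0 hD (by have := mul_pos hε ht0; linarith) hsec.1
    (div_nonpos_of_nonpos_of_nonneg hsec.2 (hρ x t hD).le)
  have hdt := (sv.hdt (hU x)).sub ((hasDerivAt_id t).const_mul ε)
  have : 0 ≤ pdt v x t - ε * 1 := by
    have htd := (hasDerivAt_iff_tendsto_slope.1 hdt).mono_left
      (nhdsWithin_mono t (show Iio t ⊆ {t}ᶜ from fun y hy => ne_of_lt hy))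
    refine ge_of_tendsto htd ?_
    filter_upwards [Ioo_mem_nhdsLT ht0] with s hs
    rw [slope_def_field]
    have := hall x s hs.1.le (hs.2.le.trans ht.2)
    apply div_nonneg_of_nonpos
    · simp only [Pi.sub_apply, id]; linarith
    · linarith [hs.2]
  linarith

lemma Ds_neg (ρ v : ℝ → ℝ → ℝ) : Ds ρ (fun x t => - v x t) = fun x t => - Ds ρ v x t := by
  funext x t
  simp only [Ds, pd1, deriv.fun_neg, neg_div]

lemma maxPrincipleAbs {T : ℝ≥0∞} {ρ v : ℝ → ℝ → ℝ} (hρ : ∀ ξ t, InDom T t → 0 < ρ ξ t)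
    (sρ : Sm T ρ) (sv : Sm T v) (per : ∀ ξ t, v (ξ + 2 * π) t = v ξ t)
    (cont : ContinuousOn (fun p : ℝ × ℝ => v p.1 p.2) (univ ×ˢ {t : ℝ | InDom T t}))
    (C : ℝ) (h0 : ∀ ξ, |v ξ 0| ≤ C)
    (key : ∀ ξ t, 0 < t → InDom T t → C < v ξ t → Ds ρ v ξ t = 0 → Ds ρ (Ds ρ v) ξ t ≤ 0 →
      pdt v ξ t ≤ 0)
    (key' : ∀ ξ t, 0 < t → InDom T t → C < - v ξ t → Ds ρ v ξ t = 0 → 0 ≤ Ds ρ (Ds ρ v) ξ t →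
      0 ≤ pdt v ξ t) :
    ∀ ξ t, InDom T t → |v ξ t| ≤ C := by
  intro ξ t h
  have a := maxPrinciple hρ sρ sv per cont C (fun ξ => (abs_le.1 (h0 ξ)).2) key ξ t h
  have b := maxPrinciple hρ sρ sv.neg (fun ξ t => by rw [per]) cont.neg C
    (fun ξ => by linarith [(abs_le.1 (h0 ξ)).1])
    (by
      intro ξ t h1 h2 h3 h4 h5
      rw [Ds_neg] at h4 h5
      rw [Ds_neg] at h5
      have := key' ξ t h1 h2 h3 (by linarith) (by linarith)
      simp only [pdt, deriv.fun_neg] at this ⊢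
      linarith) ξ t h
  exact abs_le.2 ⟨by linarith, a⟩

lemma dom_uniq {T : ℝ≥0∞} (hT : 0 < T) :
    UniqueDiffOn ℝ ((univ : Set ℝ) ×ˢ {t : ℝ | InDom T t}) := by
  refine uniqueDiffOn_univ.prod ?_
  obtain ⟨δ, hδ, hδT⟩ := ENNReal.lt_iff_exists_real_btwn.1 hT
  have hδ0 : 0 < δ := ENNReal.ofReal_pos.1 hδT.1
  refine uniqueDiffOn_convex ?_ ⟨δ / 2, ?_⟩
  · apply OrdConnected.convex
    constructor
    intro a ha b hb c hc
    exact ⟨ha.1.trans hc.1, lt_of_le_of_lt (ENNReal.ofReal_le_ofReal hc.2) hb.2⟩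
  · rw [mem_interior]
    refine ⟨Ioo 0 δ, ?_, isOpen_Ioo, by constructor <;> linarith⟩
    intro c hc
    exact ⟨hc.1.le, lt_of_le_of_lt (ENNReal.ofReal_le_ofReal hc.2.le) hδT.2⟩

lemma Ds_cont {T : ℝ≥0∞} (hT : 0 < T) {ρ φ : ℝ → ℝ → ℝ} (hρ : ∀ ξ t, InDom T t → 0 < ρ ξ t)
    (hφ : ContDiffOn ℝ (⊤ : ℕ∞) (fun p : ℝ × ℝ => φ p.1 p.2) (univ ×ˢ {t : ℝ | InDom T t}))
    (hρc : ContinuousOn (fun p : ℝ × ℝ => ρ p.1 p.2) (univ ×ˢ {t : ℝ | InDom T t})) :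
    ContinuousOn (fun p : ℝ × ℝ => Ds ρ φ p.1 p.2) (univ ×ˢ {t : ℝ | InDom T t}) := by
  refine ContinuousOn.div ?_ hρc (fun p hp => (hρ p.1 p.2 hp.2).ne')
  have h1 := (hφ.continuousOn_fderivWithin (dom_uniq hT) (by simp)).clm_apply
    (continuousOn_const (c := ((1, 0) : ℝ × ℝ)))
  refine h1.congr ?_
  rintro ⟨ξ, t⟩ hp
  have hd := ((hφ.differentiableOn (by simp)) (ξ, t) hp).hasFDerivWithinAt
  have := HasFDerivWithinAt.comp_hasDerivAt (f := fun x : ℝ => (x, t)) ξ hd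
    ((hasDerivAt_id ξ).prodMk (hasDerivAt_const ξ t))
    (Eventually.of_forall fun x => ⟨trivial, hp.2⟩)
  exact this.deriv

lemma Ds_per {ρ φ : ℝ → ℝ → ℝ} (hρ : ∀ ξ t : ℝ, ρ (ξ + 2 * π) t = ρ ξ t)
    (hφ : ∀ ξ t : ℝ, φ (ξ + 2 * π) t = φ ξ t) (ξ t : ℝ) :
    Ds ρ φ (ξ + 2 * π) t = Ds ρ φ ξ t := by
  unfold Ds pd1
  rw [hρ, ← deriv_comp_add_const]
  simp only [hφ]

lemma le_sup_init {T : ℝ≥0∞} (hT : 0 < T) {v : ℝ → ℝ → ℝ}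
    (per : ∀ ξ t, v (ξ + 2 * π) t = v ξ t)
    (cont : ContinuousOn (fun p : ℝ × ℝ => v p.1 p.2) (univ ×ˢ {t : ℝ | InDom T t})) (ξ : ℝ) :
    |v ξ 0| ≤ ⨆ ξ' : ℝ, |v ξ' 0| := by
  refine le_ciSup (f := fun ξ' => |v ξ' 0|) ?_ ξ
  have hc : Continuous fun ξ' => |v ξ' 0| := by
    refine Continuous.abs ?_
    exact cont.comp_continuous (f := fun x : ℝ => (x, (0:ℝ))) (by fun_prop)
      (fun x => ⟨trivial, le_rfl, by simpa using hT⟩)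
  have hp : Function.Periodic (fun ξ' => |v ξ' 0|) (2 * π) := fun z => by simp only [per]
  obtain ⟨B, hB⟩ := (isCompact_Icc (a := (0:ℝ)) (b := 2 * π)).bddAbove_image hc.continuousOn
  refine ⟨B, ?_⟩
  rintro _ ⟨y, rfl⟩
  obtain ⟨z, hz, hz'⟩ := hp.exists_mem_Ico₀ (by positivity) y
  have e : |v y 0| = |v z 0| := hz'
  simp only [e]
  exact hB ⟨z, ⟨hz.1, hz.2.le⟩, rfl⟩

lemma Sm.hds {T : ℝ≥0∞} {ρ φ : ℝ → ℝ → ℝ} (h : Sm T φ) (hρ : ∀ ξ t, InDom T t → 0 < ρ ξ t)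
    {ξ t : ℝ} (ht : (ξ, t) ∈ UU T) :
    HasDerivAt (fun x => φ x t) (ρ ξ t * _root_.Ds ρ φ ξ t) ξ := by
  have e : ρ ξ t * _root_.Ds ρ φ ξ t = _root_.pd1 φ ξ t := by
    have := (hρ ξ t ⟨ht.1.le, ht.2⟩).ne'
    unfold _root_.Ds; field_simp
  rw [e]; exact h.hd1 ht

lemma ds_comm {T : ℝ≥0∞} {ρ φ : ℝ → ℝ → ℝ} (h : Sm T φ) (sρ : Sm T ρ)
    (hρ : ∀ ξ t, InDom T t → 0 < ρ ξ t) {ξ t : ℝ} (ht : (ξ, t) ∈ UU T) :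
    pdt (Ds ρ φ) ξ t = Ds ρ (pdt φ) ξ t
      - pdt (fun x τ => Real.log (ρ x τ)) ξ t * Ds ρ φ ξ t := by
  have hr := (hρ ξ t ⟨ht.1.le, ht.2⟩).ne'
  have e1 : pdt (Ds ρ φ) ξ t = _ := ((h.pd1.hdt ht).fun_div (sρ.hdt ht) hr).deriv
  have e2 : pdt (fun x τ => Real.log (ρ x τ)) ξ t = _ := ((sρ.hdt ht).log hr).deriv
  rw [e1, e2, h.comm ht]
  unfold Ds
  field_simp

section evo
variable {T : ℝ≥0∞} {f g ρ : ℝ → ℝ → ℝ}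

lemma WarpedBerger.cf (sol : WarpedBerger T f g ρ) :
    ContDiffOn ℝ (⊤ : ℕ∞) (fun p : ℝ × ℝ => f p.1 p.2) (univ ×ˢ {t : ℝ | InDom T t}) :=
  sol.smooth.fst
lemma WarpedBerger.cg (sol : WarpedBerger T f g ρ) :
    ContDiffOn ℝ (⊤ : ℕ∞) (fun p : ℝ × ℝ => g p.1 p.2) (univ ×ˢ {t : ℝ | InDom T t}) :=
  sol.smooth.snd.fst
lemma WarpedBerger.cρ (sol : WarpedBerger T f g ρ) :
    ContDiffOn ℝ (⊤ : ℕ∞) (fun p : ℝ × ℝ => ρ p.1 p.2) (univ ×ˢ {t : ℝ | InDom T t}) :=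
  sol.smooth.snd.snd
lemma UU_sub : UU T ⊆ (univ : Set ℝ) ×ˢ {t : ℝ | InDom T t} :=
  fun _ hp => ⟨trivial, hp.1.le, hp.2⟩
lemma WarpedBerger.sf (sol : WarpedBerger T f g ρ) : Sm T f := sol.cf.mono UU_sub
lemma WarpedBerger.sg (sol : WarpedBerger T f g ρ) : Sm T g := sol.cg.mono UU_sub
lemma WarpedBerger.sρ (sol : WarpedBerger T f g ρ) : Sm T ρ := sol.cρ.mono UU_sub

lemma evo_f (sol : WarpedBerger T f g ρ) {ξ t : ℝ} (ht : (ξ, t) ∈ UU T) :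
    pdt (Ds ρ f) ξ t = Ds ρ (Ds ρ (Ds ρ f)) ξ t
      + (2 * Ds ρ g ξ t / g ξ t - Ds ρ f ξ t / f ξ t) * Ds ρ (Ds ρ f) ξ t
      - (6 * f ξ t ^ 2 / g ξ t ^ 4 + 2 * Ds ρ g ξ t ^ 2 / g ξ t ^ 2) * Ds ρ f ξ t
      + 8 * f ξ t ^ 3 * Ds ρ g ξ t / g ξ t ^ 5 := by
  have hD : InDom T t := ⟨ht.1.le, ht.2⟩
  have hf := (sol.f_pos ξ t hD).ne'
  have hg := (sol.g_pos ξ t hD).ne'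
  have hr := (sol.ρ_pos ξ t hD).ne'
  have sa := sol.sf.Ds sol.sρ sol.ρ_pos
  have sb := sol.sg.Ds sol.sρ sol.ρ_pos
  have saa := sa.Ds sol.sρ sol.ρ_pos
  have df := sol.sf.hds sol.ρ_pos ht
  have dg := sol.sg.hds sol.ρ_pos ht
  have da := sa.hds sol.ρ_pos ht
  have db := sb.hds sol.ρ_pos ht
  have daa := saa.hds sol.ρ_pos ht
  rw [ds_comm sol.sf sol.sρ sol.ρ_pos ht, sol.eq_ρ ξ t ht.1 hD]
  have hline : (fun x => pdt f x t) = fun x => _ := funext fun x => sol.eq_f x t ht.1 hD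
  have e : Ds ρ (pdt f) ξ t = deriv (fun x => pdt f x t) ξ / ρ ξ t := rfl
  rw [hline, ((daa.fun_add (((db.fun_div dg hg).const_mul 2).fun_mul da)).fun_sub
    (((df.fun_pow 3).const_mul 2).fun_div (dg.fun_pow 4) (pow_ne_zero 4 hg))).deriv] at e
  rw [e]
  field_simp
  ring

lemma evo_g (sol : WarpedBerger T f g ρ) {ξ t : ℝ} (ht : (ξ, t) ∈ UU T) :
    pdt (Ds ρ g) ξ t = Ds ρ (Ds ρ (Ds ρ g)) ξ t
      + (Ds ρ f ξ t / f ξ t) * Ds ρ (Ds ρ g) ξ t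
      - (Ds ρ f ξ t ^ 2 / f ξ t ^ 2 + Ds ρ g ξ t ^ 2 / g ξ t ^ 2 + 6 * f ξ t ^ 2 / g ξ t ^ 4
        - 4 / g ξ t ^ 2) * Ds ρ g ξ t
      + 4 * f ξ t * Ds ρ f ξ t / g ξ t ^ 3 := by
  have hD : InDom T t := ⟨ht.1.le, ht.2⟩
  have hf := (sol.f_pos ξ t hD).ne'
  have hg := (sol.g_pos ξ t hD).ne'
  have hr := (sol.ρ_pos ξ t hD).ne'
  have sa := sol.sf.Ds sol.sρ sol.ρ_pos
  have sb := sol.sg.Ds sol.sρ sol.ρ_pos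
  have sbb := sb.Ds sol.sρ sol.ρ_pos
  have df := sol.sf.hds sol.ρ_pos ht
  have dg := sol.sg.hds sol.ρ_pos ht
  have da := sa.hds sol.ρ_pos ht
  have db := sb.hds sol.ρ_pos ht
  have dbb := sbb.hds sol.ρ_pos ht
  rw [ds_comm sol.sg sol.sρ sol.ρ_pos ht, sol.eq_ρ ξ t ht.1 hD]
  have hline : (fun x => pdt g x t) = fun x => _ := funext fun x => sol.eq_g x t ht.1 hD
  have e : Ds ρ (pdt g) ξ t = deriv (fun x => pdt g x t) ξ / ρ ξ t := rfl
  rw [hline, ((dbb.fun_add (((da.fun_div df hf).fun_add (db.fun_div dg hg)).fun_mul db)).fun_add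
    ((((df.fun_pow 2).fun_sub ((dg.fun_pow 2).const_mul 2)).const_mul 2).fun_div
      (dg.fun_pow 3) (pow_ne_zero 3 hg))).deriv] at e
  rw [e]
  field_simp
  ring

lemma order_pres (sol : WarpedBerger T f g ρ) (h_order : ∀ ξ : ℝ, f ξ 0 ≤ g ξ 0) :
    ∀ ξ t : ℝ, InDom T t → f ξ t ≤ g ξ t := by
  intro ξ t h
  rw [← div_le_one (sol.g_pos ξ t h)]
  have h00 : InDom T 0 := ⟨le_rfl, by simpa using sol.T_pos⟩
  refine maxPrinciple (v := fun ξ t => f ξ t / g ξ t) sol.ρ_pos sol.sρ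
    (sol.sf.div sol.sg sol.g_pos) (fun ξ t => by rw [sol.f_per, sol.g_per])
    (sol.cf.continuousOn.div sol.cg.continuousOn (fun p hp => (sol.g_pos p.1 p.2 hp.2).ne'))
    1 (fun ξ => by rw [div_le_one (sol.g_pos ξ 0 h00)]; exact h_order ξ) ?_ ξ t h
  clear h ξ t
  intro ξ t ht0 hD h1 h2 h3
  have ht : ∀ x, (x, t) ∈ UU T := fun x => ⟨ht0, hD.2⟩
  have hfp := sol.f_pos ξ t hD
  have hgp := sol.g_pos ξ t hD
  have hf := hfp.ne'
  have hg := hgp.ne'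
  have hr := (sol.ρ_pos ξ t hD).ne'
  have sa := sol.sf.Ds sol.sρ sol.ρ_pos
  have sb := sol.sg.Ds sol.sρ sol.ρ_pos
  have df := sol.sf.hds sol.ρ_pos (ht ξ)
  have dg := sol.sg.hds sol.ρ_pos (ht ξ)
  have da := sa.hds sol.ρ_pos (ht ξ)
  have db := sb.hds sol.ρ_pos (ht ξ)
  have eD : ∀ x, Ds ρ (fun ξ t => f ξ t / g ξ t) x t
      = (Ds ρ f x t * g x t - f x t * Ds ρ g x t) / g x t ^ 2 := by
    intro x
    have hg := (sol.g_pos x t hD).ne'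
    have hr := (sol.ρ_pos x t hD).ne'
    have e : pd1 (fun ξ t => f ξ t / g ξ t) x t = _ :=
      ((sol.sf.hds sol.ρ_pos (ht x)).fun_div (sol.sg.hds sol.ρ_pos (ht x)) hg).deriv
    rw [Ds, e]
    field_simp
  have eDD : Ds ρ (Ds ρ (fun ξ t => f ξ t / g ξ t)) ξ t
      = deriv (fun x => Ds ρ (fun ξ t => f ξ t / g ξ t) x t) ξ / ρ ξ t := rfl
  rw [funext eD, (((da.fun_mul dg).fun_sub (df.fun_mul db)).fun_div (dg.fun_pow 2)
    (pow_ne_zero 2 hg)).deriv] at eDD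
  have et : pdt (fun ξ t => f ξ t / g ξ t) ξ t = _ :=
    ((sol.sf.hdt (ht ξ)).fun_div (sol.sg.hdt (ht ξ)) hg).deriv
  rw [eD] at h2
  rw [eDD] at h3
  rw [et, sol.eq_f ξ t ht0 hD, sol.eq_g ξ t ht0 hD]
  have h2' : Ds ρ f ξ t * g ξ t - f ξ t * Ds ρ g ξ t = 0 := by
    simpa [hg] using h2
  have ha : Ds ρ f ξ t = f ξ t * Ds ρ g ξ t / g ξ t := by field_simp; linarith
  have hfg : g ξ t < f ξ t := by rwa [one_lt_div hgp] at h1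
  rw [ha] at h3 ⊢
  generalize Ds ρ (Ds ρ f) ξ t = A at *
  generalize Ds ρ (Ds ρ g) ξ t = B at *
  generalize Ds ρ g ξ t = b at *
  generalize f ξ t = F at *
  generalize g ξ t = G at *
  generalize ρ ξ t = r at *
  have h4 : (A * G - F * B) / G ^ 2 ≤ 0 := by
    refine le_of_eq_of_le ?_ h3
    field_simp
    ring
  have h5 : 4 * F / G ^ 5 * (G ^ 2 - F ^ 2) ≤ 0 :=
    mul_nonpos_of_nonneg_of_nonpos (by positivity) (by nlinarith)
  refine le_of_eq_of_le ?_ (add_nonpos h4 h5)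
  field_simp
  ring

end evo

lemma alg_f {C a b F G : ℝ} (hC : 2 / √3 ≤ C) (ha : C < a) (hF : 0 < F) (hFG : F ≤ G) :
    8 * F ^ 3 * b / G ^ 5 ≤ (6 * F ^ 2 / G ^ 4 + 2 * b ^ 2 / G ^ 2) * a := by
  have hG : 0 < G := lt_of_lt_of_le hF hFG
  have h3 : 0 < √3 := by positivity
  have h33 : √3 * √3 = 3 := Real.mul_self_sqrt (by norm_num)
  have ha' : 2 ≤ √3 * a := by
    have := hC.trans ha.le
    rw [div_le_iff₀ h3] at this; linarith
  have ha0 : 0 < a := by nlinarith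
  set x := |b| / G with hx
  set y := F / G ^ 2 with hy
  set w := F / G with hw
  have hw0 : 0 ≤ w := by positivity
  have hw1 : w ≤ 1 := (div_le_one hG).2 hFG
  have hx0 : 0 ≤ x := by positivity
  have hy0 : 0 ≤ y := by positivity
  have hxb : b ^ 2 = |b| ^ 2 := (sq_abs b).symm
  have e1 : (6 * F ^ 2 / G ^ 4 + 2 * b ^ 2 / G ^ 2) * a = (6 * y ^ 2 + 2 * x ^ 2) * a := by
    rw [hx, hy, hxb]; field_simp
  have e2 : 8 * F ^ 3 * b / G ^ 5 ≤ 8 * w ^ 2 * (y * x) := by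
    have : 8 * w ^ 2 * (y * x) = 8 * F ^ 3 * |b| / G ^ 5 := by
      rw [hx, hy, hw]; field_simp
    rw [this]
    gcongr
    exact le_abs_self b
  rw [e1]
  have hxy : 0 ≤ y * x := by positivity
  have hw2 : w ^ 2 ≤ 1 := by nlinarith
  have s1 : 8 * w ^ 2 * (y * x) ≤ 8 * (y * x) := by nlinarith
  have s2 : 4 * √3 * (y * x) ≤ 6 * y ^ 2 + 2 * x ^ 2 := by
    nlinarith [sq_nonneg (√3 * y - x)]
  have s3 := mul_le_mul_of_nonneg_right s2 ha0.le
  nlinarith [mul_le_mul_of_nonneg_right ha' hxy]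

lemma alg_g {C a b F G : ℝ} (hC : 2 * √2 ≤ C) (hb : C < b) (hF : 0 < F) (hFG : F ≤ G) :
    4 * F * a / G ^ 3 ≤
      (a ^ 2 / F ^ 2 + b ^ 2 / G ^ 2 + 6 * F ^ 2 / G ^ 4 - 4 / G ^ 2) * b := by
  have hG : 0 < G := lt_of_lt_of_le hF hFG
  have h22 : √2 * √2 = 2 := Real.mul_self_sqrt (by norm_num)
  have h20 : 0 ≤ √2 := by positivity
  have hb0 : 2 ≤ b := by nlinarith
  have hb8 : 8 ≤ b ^ 2 := by nlinarith
  set w := F / G with hw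
  set c := a * G / F with hc
  have hw0 : 0 ≤ w := by positivity
  have hw1 : w ≤ 1 := (div_le_one hG).2 hFG
  have hw2 : w ^ 2 ≤ 1 := by nlinarith
  have e1 : (a ^ 2 / F ^ 2 + b ^ 2 / G ^ 2 + 6 * F ^ 2 / G ^ 4 - 4 / G ^ 2) * b
      = (c ^ 2 + b ^ 2 + 6 * w ^ 2 - 4) * b / G ^ 2 := by
    rw [hw, hc]; field_simp
  have e2 : 4 * F * a / G ^ 3 = 4 * w ^ 2 * c / G ^ 2 := by
    rw [hw, hc]; field_simp
  rw [e1, e2]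
  refine div_le_div_of_nonneg_right ?_ (by positivity)
  have h1 : 4 * w ^ 2 * c ≤ (c ^ 2 + 4) * 2 := by
    nlinarith [sq_nonneg (c - w ^ 2), sq_nonneg w]
  have h2 : (c ^ 2 + 4) * 2 ≤ (c ^ 2 + b ^ 2 + 6 * w ^ 2 - 4) * b :=
    mul_le_mul (by nlinarith [sq_nonneg w]) hb0 (by norm_num) (by nlinarith [sq_nonneg w, sq_nonneg c])
  linarith

/-- If `f ≤ g` at `t = 0` then, with
`C_f := max {2/√3, max_ξ |f_s(ξ,0)|}` and `C_g := max {2√2, max_ξ |g_s(ξ,0)|}`, one has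
`|f_s| ≤ C_f` and `|g_s| ≤ C_g` for as long as the solution exists. -/
theorem gradient_bounds (T : ℝ≥0∞) (f g ρ : ℝ → ℝ → ℝ)
    (sol : WarpedBerger T f g ρ)
    (h_order : ∀ ξ : ℝ, f ξ 0 ≤ g ξ 0) :
    ∀ ξ t : ℝ, InDom T t →
      |Ds ρ f ξ t| ≤ max (2 / Real.sqrt 3) (⨆ ξ' : ℝ, |Ds ρ f ξ' 0|) ∧
      |Ds ρ g ξ t| ≤ max (2 * Real.sqrt 2) (⨆ ξ' : ℝ, |Ds ρ g ξ' 0|) := by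
  have hord := order_pres sol h_order
  have cρ := sol.cρ.continuousOn
  have cDf := Ds_cont sol.T_pos sol.ρ_pos sol.cf cρ
  have cDg := Ds_cont sol.T_pos sol.ρ_pos sol.cg cρ
  have pf := Ds_per sol.ρ_per sol.f_per
  have pg := Ds_per sol.ρ_per sol.g_per
  intro ξ t h
  constructor
  · refine maxPrincipleAbs sol.ρ_pos sol.sρ (sol.sf.Ds sol.sρ sol.ρ_pos) pf cDf _
      (fun ξ => (le_sup_init sol.T_pos pf cDf ξ).trans (le_max_right _ _)) ?_ ?_ ξ t h
    · intro ξ t ht0 hD h1 h2 h3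
      have := alg_f (b := Ds ρ g ξ t) (le_max_left _ _) h1 (sol.f_pos ξ t hD) (hord ξ t hD)
      rw [evo_f sol ⟨ht0, hD.2⟩, h2]
      linarith
    · intro ξ t ht0 hD h1 h2 h3
      have := alg_f (b := - Ds ρ g ξ t) (le_max_left _ _) h1 (sol.f_pos ξ t hD) (hord ξ t hD)
      rw [evo_f sol ⟨ht0, hD.2⟩, h2]
      rw [neg_sq, mul_neg, mul_neg, neg_div] at this
      linarith
  · refine maxPrincipleAbs sol.ρ_pos sol.sρ (sol.sg.Ds sol.sρ sol.ρ_pos) pg cDg _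
      (fun ξ => (le_sup_init sol.T_pos pg cDg ξ).trans (le_max_right _ _)) ?_ ?_ ξ t h
    · intro ξ t ht0 hD h1 h2 h3
      have := alg_g (a := Ds ρ f ξ t) (le_max_left _ _) h1 (sol.f_pos ξ t hD) (hord ξ t hD)
      rw [evo_g sol ⟨ht0, hD.2⟩, h2]
      linarith
    · intro ξ t ht0 hD h1 h2 h3
      have := alg_g (a := - Ds ρ f ξ t) (le_max_left _ _) h1 (sol.f_pos ξ t hD) (hord ξ t hD)
      rw [evo_g sol ⟨ht0, hD.2⟩, h2]
      rw [neg_sq, neg_sq, mul_neg, mul_neg, neg_div] at this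
      linarith
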